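/- arXiv:2408.02225 — 2 statements merged into one kernel-verified Lean document; each statement's English description precedes it below -/
import Mathlib

section
/- If G is a finite connected triangle-free graph that contains no dominated vertex and whose domination number satisfies γ(G) ≥ 3, then the attacking cop number satisfies cc(G) > 2. -/
open SimpleGraph

namespace CopsAttack

variable {V : Type*}

/-- One step of a cop or the robber: stay put or move along an edge. -/
def Step (G : SimpleGraph V) (u v : V) : Prop := u = v ∨ G.Adj u v

/-- Some (non-removed) cop occupies the robber's vertex. -/
def Capture {k : ℕ} (c : Fin k → Option V) (r : V) : Prop := ∃ i, c i = some r

/-- A legal simultaneous move of the cops: removed cops stay removed,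
active cops stay or move along an edge. -/
def CopMove (G : SimpleGraph V) {k : ℕ} (c c' : Fin k → Option V) : Prop :=
  ∀ i, (c i = none → c' i = none) ∧ ∀ v, c i = some v → ∃ w, c' i = some w ∧ Step G v w

/-- The possible cop configurations after the robber moves from `r` to `r'`:
if the robber actually moves onto a vertex occupied by a cop, exactly one cop
on that vertex is removed from the game; otherwise nothing changes. -/
def AttackResult {k : ℕ} (c : Fin k → Option V) (r r' : V) (c'' : Fin k → Option V) : Prop :=
  ((r' = r ∨ ¬ ∃ i, c i = some r') ∧ c'' = c) ∨
    (r' ≠ r ∧ ∃ i, c i = some r' ∧ c'' = Function.update c i none)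

/-- In the Cops and Attacking Robbers game, with the cops to move, the cops can
guarantee capturing the robber within `n` rounds. -/
def CopsWinIn (G : SimpleGraph V) {k : ℕ} : ℕ → (Fin k → Option V) → V → Prop
  | 0, c, r => Capture c r
  | n + 1, c, r => Capture c r ∨ ∃ c', CopMove G c c' ∧ (Capture c' r ∨
      ∀ r', Step G r r' → ∀ c'', AttackResult c' r r' c'' → CopsWinIn G n c'' r')

/-- `k` cops have a winning strategy in Cops and Attacking Robbers on `G`:
the cops choose starting vertices, and then whatever vertex the robber starts on,
the cops can capture the robber in finitely many rounds. -/
def CopsWin (G : SimpleGraph V) (k : ℕ) : Prop :=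
  ∃ init : Fin k → V, ∀ r : V, ∃ n, CopsWinIn G n (fun i => some (init i)) r

/-- The attacking cop number `cc(G)`. -/
noncomputable def attCop (G : SimpleGraph V) : ℕ := sInf {k | CopsWin G k}

/-- In the classical Cops and Robbers game, with the cops to move, the cops can
guarantee capturing the robber within `n` rounds. -/
def ClassicCopsWinIn (G : SimpleGraph V) {k : ℕ} : ℕ → (Fin k → V) → V → Prop
  | 0, c, r => ∃ i, c i = r
  | n + 1, c, r => (∃ i, c i = r) ∨ ∃ c', (∀ i, Step G (c i) (c' i)) ∧
      ((∃ i, c' i = r) ∨ ∀ r', Step G r r' → ClassicCopsWinIn G n c' r')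

/-- `k` cops have a winning strategy in classical Cops and Robbers on `G`. -/
def ClassicCopsWin (G : SimpleGraph V) (k : ℕ) : Prop :=
  ∃ init : Fin k → V, ∀ r : V, ∃ n, ClassicCopsWinIn G n init r

/-- The cop number `c(G)`. -/
noncomputable def copNumber (G : SimpleGraph V) : ℕ := sInf {k | ClassicCopsWin G k}

/-- A dominating set of a graph. -/
def IsDomSet (G : SimpleGraph V) (s : Set V) : Prop := ∀ v, v ∈ s ∨ ∃ u ∈ s, G.Adj u v

/-- The domination number `γ(G)`. -/
noncomputable def domNumber (G : SimpleGraph V) : ℕ :=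
  sInf {n | ∃ s : Finset V, s.card = n ∧ IsDomSet G ↑s}

/-- `v` dominates `u` (`u ≠ v`) if `N(u) ⊆ N[v]`. -/
def Dominates (G : SimpleGraph V) (v u : V) : Prop :=
  v ≠ u ∧ G.neighborSet u ⊆ insert v (G.neighborSet v)


/-- No cop lies in the closed neighbourhood of the robber's vertex. -/
def Safe (G : SimpleGraph V) {k : ℕ} (c : Fin k → Option V) (r : V) : Prop :=
  ∀ i v, c i = some v → ¬ Step G v r

/-- If no vertex dominates `r`, every other vertex `b` misses some neighbour of `r`. -/
lemma exists_adj_not_step {G : SimpleGraph V} {r b : V}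
    (hnodom : ¬ ∃ v : V, Dominates G v r) (hb : b ≠ r) :
    ∃ w, G.Adj r w ∧ ¬ Step G b w := by
  by_contra! h
  refine hnodom ⟨b, hb, fun w hw => ?_⟩
  rcases h w hw with rfl | h
  · exact Set.mem_insert _ _
  · exact Set.mem_insert_of_mem _ h

/-- In a triangle-free graph without dominated vertices, a robber that at most two cops have
not captured can always move, possibly by an attack, to a position that is safe from them. -/
lemma exists_safe_response {G : SimpleGraph V} (htf : G.CliqueFree 3)
    (hnodom : ∀ u : V, ¬ ∃ v : V, Dominates G v u) {k : ℕ} (hk : k ≤ 2)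
    (c : Fin k → Option V) (r : V) (hcap : ¬ Capture c r) :
    ∃ r', Step G r r' ∧ ∃ c'', AttackResult c r r' c'' ∧ Safe G c'' r' := by
  classical
  by_cases hsafe : Safe G c r
  · exact ⟨r, Or.inl rfl, c, Or.inl ⟨Or.inl rfl, rfl⟩, hsafe⟩
  have hthreat : ∃ i a, c i = some a ∧ G.Adj a r := by
    simp only [Safe, not_forall, not_not] at hsafe
    obtain ⟨i, a, hi, rfl | ha⟩ := hsafe
    · exact absurd ⟨i, hi⟩ hcap
    · exact ⟨i, a, hi, ha⟩
  obtain ⟨i, a, hi, ha⟩ := hthreat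
  have htri : ∀ w, G.Adj r w → ¬ G.Adj a w := fun w hrw haw =>
    htf {a, r, w} (is3Clique_triple_iff.2 ⟨ha, haw, hrw⟩)
  have hevade : ∀ w, G.Adj r w → Safe G c w →
      ∃ r', Step G r r' ∧ ∃ c'', AttackResult c r r' c'' ∧ Safe G c'' r' := fun w hrw hw =>
    ⟨w, Or.inr hrw, c, Or.inl ⟨Or.inr fun ⟨j, hj⟩ => hw j w hj (Or.inl rfl), rfl⟩, hw⟩
  by_cases hother : ∃ j b, j ≠ i ∧ c j = some b
  · obtain ⟨j, b, hji, hj⟩ := hother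
    have hb : b ≠ r := by
      rintro rfl
      exact hcap ⟨j, hj⟩
    have hall : ∀ l, l = i ∨ l = j := fun l => by
      by_contra! h
      simp only [ne_eq, Fin.ext_iff] at h hji
      omega
    obtain ⟨w, hrw, hbw⟩ := exists_adj_not_step (hnodom r) hb
    by_cases hwa : a = w
    · subst hwa
      refine ⟨a, Or.inr hrw, Function.update c i none,
        Or.inr ⟨hrw.ne', i, hi, rfl⟩, fun l v hl => ?_⟩
      rcases hall l with rfl | rfl
      · simp at hl
      · rw [Function.update_of_ne hji, hj, Option.some.injEq] at hl
        exact hl ▸ hbw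
    · refine hevade w hrw fun l v hl => ?_
      rcases hall l with rfl | rfl
      · rw [hi, Option.some.injEq] at hl
        subst hl
        exact not_or.2 ⟨hwa, htri w hrw⟩
      · rw [hj, Option.some.injEq] at hl
        exact hl ▸ hbw
  · obtain ⟨w, hrw, haw⟩ := exists_adj_not_step (hnodom r) ha.ne
    refine hevade w hrw fun l v hl => ?_
    by_cases hli : l = i
    · rw [hli, hi, Option.some.injEq] at hl
      exact hl ▸ haw
    · exact absurd ⟨l, v, hli, hl⟩ hother

/-- A safe robber is not captured by any move of the cops. -/
lemma Safe.not_capture_of_copMove {G : SimpleGraph V} {k : ℕ} {c c' : Fin k → Option V} {r : V}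
    (hsafe : Safe G c r) (hmove : CopMove G c c') : ¬ Capture c' r := by
  rintro ⟨i, hi⟩
  cases hc : c i with
  | none => simp [(hmove i).1 hc] at hi
  | some v =>
    obtain ⟨w, hw, hstep⟩ := (hmove i).2 v hc
    rw [hi, Option.some.injEq] at hw
    exact hsafe i v hc (hw ▸ hstep)

/-- From a safe position the robber evades at most two cops forever. -/
lemma Safe.not_copsWinIn {G : SimpleGraph V} (htf : G.CliqueFree 3)
    (hnodom : ∀ u : V, ¬ ∃ v : V, Dominates G v u) {k : ℕ} (hk : k ≤ 2) (n : ℕ)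
    {c : Fin k → Option V} {r : V} (hsafe : Safe G c r) : ¬ CopsWinIn G n c r := by
  have hcap : ∀ {c : Fin k → Option V} {r : V}, Safe G c r → ¬ Capture c r :=
    fun h ⟨i, hi⟩ => h i _ hi (Or.inl rfl)
  induction n generalizing c r with
  | zero => exact hcap hsafe
  | succ n ih =>
    rintro (h | ⟨c', hmove, h | h⟩)
    · exact hcap hsafe h
    · exact hsafe.not_capture_of_copMove hmove h
    · obtain ⟨r', hr', c'', hc'', hs⟩ := exists_safe_response htf hnodom hk c' r
        (hsafe.not_capture_of_copMove hmove)
      exact ih hs (h r' hr' c'' hc'')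

/-- A cop on every vertex wins at once. -/
lemma copsWin_card [Fintype V] (G : SimpleGraph V) : CopsWin G (Fintype.card V) :=
  ⟨(Fintype.equivFin V).symm, fun r => ⟨0, Fintype.equivFin V r, by simp⟩⟩

/-- Fewer cops than the domination number leave a safe starting vertex for the robber. -/
lemma exists_safe_of_lt_domNumber {G : SimpleGraph V} {k : ℕ} (hk : k < domNumber G)
    (init : Fin k → V) : ∃ r, Safe G (fun i => some (init i)) r := by
  classical
  by_contra! h
  have hdom : IsDomSet G ↑(Finset.univ.image init) := fun r => by
    have hr := h r
    simp only [Safe, not_forall, not_not, Option.some.injEq] at hr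
    obtain ⟨i, v, rfl, rfl | hadj⟩ := hr
    · exact Or.inl (by simp)
    · exact Or.inr ⟨init i, by simp, hadj⟩
  have hle : domNumber G ≤ (Finset.univ.image init).card := Nat.sInf_le ⟨_, rfl, hdom⟩
  have hcard : (Finset.univ.image init).card ≤ k := by
    simpa using Finset.card_image_le (s := Finset.univ) (f := init)
  omega

/-- If `G` is a finite connected triangle-free graph with no dominated vertex and
`γ(G) ≥ 3`, then `cc(G) > 2`. -/
theorem stmt_1 {V : Type*} [Fintype V] (G : SimpleGraph V)
    (hconn : G.Connected) (htf : G.CliqueFree 3)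
    (hnodom : ∀ u : V, ¬ ∃ v : V, Dominates G v u)
    (hγ : 3 ≤ domNumber G) :
    2 < attCop G := by
  by_contra! hk
  obtain ⟨init, hwin⟩ : CopsWin G (attCop G) :=
    Nat.sInf_mem (s := {k | CopsWin G k}) ⟨_, copsWin_card G⟩
  obtain ⟨r, hr⟩ := exists_safe_of_lt_domNumber (G := G) (by omega) init
  obtain ⟨n, hn⟩ := hwin r
  exact hr.not_copsWinIn htf hnodom hk n hn

end CopsAttack
end

section
/- If G is a finite connected bipartite graph and P is a geodesic path in G, then P is (1,1)-guardable in the game of Cops and Attacking Robbers on G. -/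
open SimpleGraph

namespace CopsAttack

variable {V : Type*}

/-- A guarding invariant for `k + t` cops guarding the vertex set `P`, where the first `k`
cops are the guards.  `S` is a set of game states (cop configuration, robber vertex,
cops to move) such that in every state of `S` the `k` guards stand on `P`, and the cops
have a move keeping the guards on `P` (or capturing the robber) after which, for every
robber move (including attacks): if the robber moved into `P` it is captured immediately
by a guard, and otherwise the resulting state is again in `S`. -/
def GuardInvariant (G : SimpleGraph V) (P : Set V) (k t : ℕ)
    (S : Set ((Fin (k + t) → Option V) × V)) : Prop :=
  ∀ p ∈ S,
    (∀ i : Fin (k + t), (i : ℕ) < k → ∃ v ∈ P, p.1 i = some v) ∧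
      ∃ c', CopMove G p.1 c' ∧
        (Capture c' p.2 ∨
          ((∀ i : Fin (k + t), (i : ℕ) < k → ∃ v ∈ P, c' i = some v) ∧
            ∀ r', Step G p.2 r' → ∀ c'', AttackResult c' p.2 r' c'' →
              (r' ∈ P → ∃ i : Fin (k + t), (i : ℕ) < k ∧
                  ∃ v, c'' i = some v ∧ Step G v r') ∧
                (r' ∉ P → (c'', r') ∈ S)))

/-- With the cops to move, the cops can in at most `n` rounds reach a state in `S`
(or capture the robber outright), whatever the robber does. -/
def ReachIn (G : SimpleGraph V) {m : ℕ} (S : Set ((Fin m → Option V) × V)) :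
    ℕ → (Fin m → Option V) → V → Prop
  | 0, c, r => (c, r) ∈ S ∨ Capture c r
  | n + 1, c, r => (c, r) ∈ S ∨ Capture c r ∨ ∃ c', CopMove G c c' ∧
      (Capture c' r ∨ ∀ r', Step G r r' → ∀ c'', AttackResult c' r r' c'' →
        ReachIn G S n c'' r')

/-- `P` is `(k,t)`-guardable in the game of Cops and Attacking Robbers on `G`:
`k + t` cops can move so that after finitely many rounds `k` cops occupy vertices of `P`,
and thereafter these `k` cops guarantee that the robber is captured immediately whenever
it moves to a vertex of `P`. -/
def Guardable (G : SimpleGraph V) (P : Set V) (k t : ℕ) : Prop :=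
  ∃ S : Set ((Fin (k + t) → Option V) × V), GuardInvariant G P k t S ∧
    ∃ init : Fin (k + t) → V, ∀ r : V, ∃ n, ReachIn G S n (fun i => some (init i)) r

/-- A capture already achieved counts as reaching any target set. -/
lemma ReachIn.of_capture {G : SimpleGraph V} {m : ℕ} {S : Set ((Fin m → Option V) × V)}
    {c : Fin m → Option V} {r : V} (h : Capture c r) : ∀ n, ReachIn G S n c r
  | 0 => Or.inr h
  | _ + 1 => Or.inr (Or.inl h)

/-- Vertices of a walk whose indices differ by at most one are a single step apart. -/
lemma step_getVert {G : SimpleGraph V} {u v : V} (p : G.Walk u v) {i j : ℕ}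
    (hi : i ≤ p.length) (hj : j ≤ p.length) (hij : i ≤ j + 1) (hji : j ≤ i + 1) :
    Step G (p.getVert i) (p.getVert j) := by
  obtain rfl | rfl | rfl : i = j ∨ j = i + 1 ∨ i = j + 1 := by omega
  · exact Or.inl rfl
  · exact Or.inr (p.adj_getVert_succ (by omega))
  · exact Or.inr (p.adj_getVert_succ (by omega)).symm

/-- The `i`-th vertex of a geodesic is at distance `i` from its start. -/
lemma dist_getVert_of_length_eq_dist {G : SimpleGraph V} (hconn : G.Connected) {u v : V}
    (p : G.Walk u v) (hgeo : p.length = G.dist u v) {i : ℕ} (hi : i ≤ p.length) :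
    G.dist u (p.getVert i) = i := by
  have h1 := dist_le (p.take i)
  have h2 := dist_le (p.drop i)
  have h3 := hconn.dist_triangle (u := u) (v := p.getVert i) (w := v)
  rw [Walk.take_length] at h1
  rw [Walk.drop_length] at h2
  omega

/-- In a connected bipartite graph, the distances from a fixed vertex to two adjacent vertices
differ by exactly one. -/
lemma dist_eq_add_one_or_of_adj {G : SimpleGraph V} (hconn : G.Connected)
    (hbip : G.Colorable 2) (u : V) {x y : V} (h : G.Adj x y) :
    G.dist u y = G.dist u x + 1 ∨ G.dist u x = G.dist u y + 1 := by
  obtain ⟨col⟩ := hbip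
  let c : G.Coloring Bool := G.recolorOfEquiv finTwoEquiv col
  obtain ⟨p, hp⟩ := hconn.exists_walk_length_eq_dist u x
  obtain ⟨q, hq⟩ := hconn.exists_walk_length_eq_dist u y
  have hpe := c.even_length_iff_congr p
  have hqe := c.even_length_iff_congr q
  have hne : c x ≠ c y := c.valid h
  have hdist : G.dist x y = 1 := dist_eq_one_iff_adj.mpr h
  have hxy := hconn.dist_triangle (u := u) (v := x) (w := y)
  have hyx := hconn.dist_triangle (u := u) (v := y) (w := x)
  rw [dist_comm (u := y) (v := x)] at hyx
  have hdne : G.dist u x ≠ G.dist u y := by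
    intro he
    rw [hp, he, ← hq, hqe] at hpe
    revert hpe hne
    cases c u <;> cases c x <;> cases c y <;> simp
  omega

/-- The distance `d` folded into `{0, …, L}` by bouncing between `L` and `L - 1` beyond `L`. -/
def foldIndex (L d : ℕ) : ℕ :=
  if d ≤ L then d else L - (d - L) % 2

lemma foldIndex_of_le {L d : ℕ} (h : d ≤ L) : foldIndex L d = d := if_pos h

lemma foldIndex_le (L d : ℕ) : foldIndex L d ≤ L := by
  unfold foldIndex
  split_ifs <;> omega

lemma foldIndex_succ {L : ℕ} (hL : 1 ≤ L) (d : ℕ) :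
    foldIndex L (d + 1) = foldIndex L d + 1 ∨ foldIndex L d = foldIndex L (d + 1) + 1 := by
  unfold foldIndex
  split_ifs <;> omega

/-- The states in which cop `0` stands on the walk `p`, at most one step away from the index
prescribed by the shadow `t` of the robber. -/
def shadowStates {G : SimpleGraph V} {u v : V} (p : G.Walk u v) (t : V → ℕ) :
    Set ((Fin (1 + 1) → Option V) × V) :=
  {s | ∃ i ≤ p.length, s.1 0 = some (p.getVert i) ∧ i ≤ t s.2 + 1 ∧ t s.2 ≤ i + 1}

/-- If the shadow moves by exactly one whenever the robber moves, and fixes the walk,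
then a cop following the shadow guards the walk. -/
lemma guardInvariant_shadowStates {G : SimpleGraph V} {u v : V} (p : G.Walk u v) (t : V → ℕ)
    (ht_le : ∀ x, t x ≤ p.length)
    (ht_adj : ∀ x y, G.Adj x y → t y = t x + 1 ∨ t x = t y + 1)
    (ht_path : ∀ i ≤ p.length, t (p.getVert i) = i) :
    GuardInvariant G {x | x ∈ p.support} 1 1 (shadowStates p t) := by
  have hzero : ∀ i : Fin (1 + 1), (i : ℕ) < 1 → i = 0 := fun i hi => Fin.ext (by simpa using hi)
  rintro ⟨c, r⟩ ⟨i, hi, hci, hit, hti⟩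
  dsimp only at hci hit hti ⊢
  refine ⟨fun j hj => ⟨p.getVert i, p.getVert_mem_support i, by rw [hzero j hj, hci]⟩,
    Function.update c 0 (some (p.getVert (t r))), fun j => ?_, Or.inr ⟨fun j hj =>
      ⟨p.getVert (t r), p.getVert_mem_support _, by rw [hzero j hj, Function.update_self]⟩, ?_⟩⟩
  · by_cases hj : j = 0
    · subst hj
      refine ⟨fun h => by simp [hci] at h, fun w hw => ⟨_, Function.update_self .., ?_⟩⟩
      obtain rfl : p.getVert i = w := by simpa [hci] using hw
      exact step_getVert p hi (ht_le r) hit hti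
    · rw [Function.update_of_ne hj]
      exact ⟨id, fun w hw => ⟨w, hw, Or.inl rfl⟩⟩
  · intro r' hr c'' hatt
    have hclose : t r ≤ t r' + 1 ∧ t r' ≤ t r + 1 := by
      rcases hr with rfl | hadj
      · omega
      · have := ht_adj _ _ hadj
        omega
    have hguard : c'' 0 = some (p.getVert (t r)) := by
      rcases hatt with ⟨-, rfl⟩ | ⟨hne, j, hj, rfl⟩
      · exact Function.update_self ..
      · have hadj : G.Adj r r' := hr.resolve_left (Ne.symm hne)
        have hj0 : (0 : Fin (1 + 1)) ≠ j := by
          rintro rfl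
          rw [Function.update_self, Option.some_inj] at hj
          have h1 := ht_path (t r) (ht_le r)
          rw [hj] at h1
          have h2 := ht_adj _ _ hadj
          omega
        rw [Function.update_of_ne hj0, Function.update_self]
    refine ⟨fun hmem => ⟨0, by simp, _, hguard, ?_⟩,
      fun _ => ⟨t r, ht_le r, hguard, hclose.1, hclose.2⟩⟩
    obtain ⟨k, rfl, hk⟩ := Walk.mem_support_iff_exists_getVert.mp hmem
    rw [ht_path k hk] at hclose
    exact step_getVert p (ht_le r) hk hclose.1 hclose.2

/-- Two cops walking together along the walk catch up with the shadow of the robber: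
an attack on one of them is answered by the other. -/
lemma reachIn_shadowStates {G : SimpleGraph V} {u v : V} (p : G.Walk u v) (t : V → ℕ)
    (ht_le : ∀ x, t x ≤ p.length)
    (ht_adj : ∀ x y, G.Adj x y → t y = t x + 1 ∨ t x = t y + 1) (n : ℕ) :
    ∀ (i : ℕ) (r : V), p.length ≤ i + n → i ≤ t r →
      ReachIn G (shadowStates p t) n (fun _ => some (p.getVert i)) r := by
  induction n with
  | zero =>
    intro i r hn hi
    have := ht_le r
    exact Or.inl ⟨i, by omega, rfl, by dsimp only; omega, by dsimp only; omega⟩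
  | succ n ih =>
    intro i r hn hi
    have hr := ht_le r
    by_cases hclose : t r ≤ i + 1
    · exact Or.inl ⟨i, by omega, rfl, by dsimp only; omega, hclose⟩
    refine Or.inr (Or.inr ⟨fun _ => some (p.getVert (i + 1)), fun j => ⟨by simp, ?_⟩,
      Or.inr ?_⟩)
    · rintro w hw
      obtain rfl : p.getVert i = w := by simpa using hw
      exact ⟨_, rfl, Or.inr (p.adj_getVert_succ (by omega))⟩
    · rintro r' hstep c'' (⟨-, rfl⟩ | ⟨-, j, hj, rfl⟩)
      · refine ih (i + 1) r' (by omega) ?_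
        rcases hstep with rfl | hadj
        · omega
        · have := ht_adj _ _ hadj
          omega
      · obtain ⟨k, hk⟩ := exists_ne j
        exact ReachIn.of_capture ⟨k, by rw [Function.update_of_ne hk]; exact hj⟩ n

/-- A single vertex is guarded by a cop standing on it, who captures any robber coming next to
it. -/
lemma guardable_singleton (G : SimpleGraph V) (u : V) : Guardable G {u} 1 1 := by
  have hzero : ∀ i : Fin (1 + 1), (i : ℕ) < 1 → i = 0 := fun i hi => Fin.ext (by simpa using hi)
  refine ⟨{s | s.1 0 = some u}, ?_, fun _ => u, fun r => ⟨0, Or.inl rfl⟩⟩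
  rintro ⟨c, r⟩ hc
  change c 0 = some u at hc
  dsimp only
  refine ⟨fun j hj => ⟨u, rfl, by rw [hzero j hj, hc]⟩, ?_⟩
  by_cases hur : Step G u r
  · refine ⟨Function.update c 0 (some r), fun j => ?_, Or.inl ⟨0, Function.update_self ..⟩⟩
    by_cases hj : j = 0
    · subst hj
      refine ⟨fun h => by simp [hc] at h, fun w hw => ⟨r, Function.update_self .., ?_⟩⟩
      obtain rfl : u = w := by simpa [hc] using hw
      exact hur
    · rw [Function.update_of_ne hj]
      exact ⟨id, fun w hw => ⟨w, hw, Or.inl rfl⟩⟩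
  · refine ⟨c, fun j => ⟨id, fun w hw => ⟨w, hw, Or.inl rfl⟩⟩,
      Or.inr ⟨fun j hj => ⟨u, rfl, by rw [hzero j hj, hc]⟩, ?_⟩⟩
    intro r' hstep c'' hatt
    have hr' : r' ≠ u := by
      rintro rfl
      exact hur (hstep.imp Eq.symm Adj.symm)
    refine ⟨fun h => absurd h hr', fun _ => ?_⟩
    rcases hatt with ⟨-, rfl⟩ | ⟨-, j, hj, rfl⟩
    · exact hc
    · have hj0 : (0 : Fin (1 + 1)) ≠ j := by
        rintro rfl
        rw [hc, Option.some_inj] at hj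
        exact hr' hj.symm
      exact (Function.update_of_ne hj0 ..).trans hc

/-- In a finite connected bipartite graph, every geodesic path is `(1,1)`-guardable. -/
theorem stmt_5 {V : Type*} [Fintype V] (G : SimpleGraph V)
    (hconn : G.Connected) (hbip : G.Colorable 2)
    {u v : V} (p : G.Walk u v) (hpath : p.IsPath) (hgeo : p.length = G.dist u v) :
    Guardable G {x | x ∈ p.support} 1 1 := by
  rcases Nat.eq_zero_or_pos p.length with hL | hL
  · cases p with
    | nil => simpa using guardable_singleton G u
    | cons => simp at hL
  · let t : V → ℕ := fun x => foldIndex p.length (G.dist u x)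
    have ht_le : ∀ x, t x ≤ p.length := fun x => foldIndex_le _ _
    have ht_adj : ∀ x y, G.Adj x y → t y = t x + 1 ∨ t x = t y + 1 := by
      intro x y hxy
      rcases dist_eq_add_one_or_of_adj hconn hbip u hxy with h | h
      · simpa only [t, h] using foldIndex_succ hL (G.dist u x)
      · simpa only [t, h] using (foldIndex_succ hL (G.dist u y)).symm
    have ht_path : ∀ i ≤ p.length, t (p.getVert i) = i := by
      intro i hi
      simp only [t, dist_getVert_of_length_eq_dist hconn p hgeo hi, foldIndex_of_le hi]
    exact ⟨shadowStates p t, guardInvariant_shadowStates p t ht_le ht_adj ht_path,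
      fun _ => p.getVert 0, fun r => ⟨p.length, reachIn_shadowStates p t ht_le ht_adj p.length 0 r
        (by omega) (Nat.zero_le _)⟩⟩

end CopsAttack
end
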